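/- arXiv:2409.00910 — 2 statements merged into one kernel-verified Lean document; each statement's English description precedes it below -/
import Mathlib

section
/- Consider a left-invariant metric γ = ε²σ¹⊗σ¹ + β²σ²⊗σ² + σ³⊗σ³ on SU(2) with ε, β ∈ (0,1]. If two eigenvalues of the Ricci endomorphism are equal, then either (i) the metric is a Berger sphere (i.e., β = 1 or ε = 1 or ε = β), or (ii) β² = 1 − ε², in which case the Ricci endomorphism has eigenvalues (0, 0, 8). -/
/-- **Lemma 2.2.** Consider the left-invariant metric
`γ = ε²σ¹⊗σ¹ + β²σ²⊗σ² + σ³⊗σ³` on `SU(2)` with `ε, β ∈ (0,1]`, whose Ricci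
endomorphism has eigenvalues `ρ₁ = 2(ε⁴ - (1-β²)²)/(ε²β²)`,
`ρ₂ = 2(β⁴ - (1-ε²)²)/(ε²β²)`, `ρ₃ = 2(1 - (ε²-β²)²)/(ε²β²)`.  If two of the
eigenvalues are equal, then either (i) the metric is a Berger sphere
(`β = 1` or `ε = 1` or `ε = β`), or (ii) `β² = 1 - ε²`, in which case the Ricci
endomorphism has eigenvalues `(0, 0, 8)`. -/
theorem repeated_ricci_eigenvalue_berger_or_exceptional (ε β ρ₁ ρ₂ ρ₃ : ℝ)
    (hε0 : 0 < ε) (hε1 : ε ≤ 1) (hβ0 : 0 < β) (hβ1 : β ≤ 1)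
    (hρ₁ : ρ₁ = 2 * (ε ^ 4 - (1 - β ^ 2) ^ 2) / (ε ^ 2 * β ^ 2))
    (hρ₂ : ρ₂ = 2 * (β ^ 4 - (1 - ε ^ 2) ^ 2) / (ε ^ 2 * β ^ 2))
    (hρ₃ : ρ₃ = 2 * (1 - (ε ^ 2 - β ^ 2) ^ 2) / (ε ^ 2 * β ^ 2))
    (hrep : ρ₁ = ρ₂ ∨ ρ₂ = ρ₃ ∨ ρ₁ = ρ₃) :
    (β = 1 ∨ ε = 1 ∨ ε = β) ∨
    (β ^ 2 = 1 - ε ^ 2 ∧ ρ₁ = 0 ∧ ρ₂ = 0 ∧ ρ₃ = 8) := by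
  have hε : ε ^ 2 ≤ 1 := pow_le_one₀ hε0.le hε1
  have hβ : β ^ 2 ≤ 1 := pow_le_one₀ hβ0.le hβ1
  have hε2 : 0 < ε ^ 2 := pow_pos hε0 2
  have hβ2 : 0 < β ^ 2 := pow_pos hβ0 2
  have hD : ε ^ 2 * β ^ 2 ≠ 0 := (mul_pos hε2 hβ2).ne'
  rcases hrep with h | h | h
  · rw [hρ₁, hρ₂, div_left_inj' hD] at h
    have hfac : (ε ^ 2 - β ^ 2) * (ε ^ 2 + β ^ 2 - 1) = 0 := by linear_combination h / 4
    rcases mul_eq_zero.mp hfac with h | h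
    · exact .inl (.inr (.inr ((pow_left_inj₀ hε0.le hβ0.le two_ne_zero).mp (sub_eq_zero.mp h))))
    · have hb : β ^ 2 = 1 - ε ^ 2 := by linear_combination h
      refine .inr ⟨hb, ?_, ?_, ?_⟩
      · rw [hρ₁, div_eq_zero_iff]
        left
        linear_combination 2 * (ε ^ 2 + 1 - β ^ 2) * h
      · rw [hρ₂, div_eq_zero_iff]
        left
        linear_combination 2 * (β ^ 2 + 1 - ε ^ 2) * h
      · rw [hρ₃, div_eq_iff hD]
        linear_combination -2 * (ε ^ 2 + β ^ 2 + 1) * h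
  · rw [hρ₂, hρ₃, div_left_inj' hD] at h
    have hfac : (β ^ 2 - 1) * (β ^ 2 + 1 - ε ^ 2) = 0 := by linear_combination h / 4
    rcases mul_eq_zero.mp hfac with h | h
    · exact .inl (.inl ((pow_eq_one_iff_of_nonneg hβ0.le two_ne_zero).mp (sub_eq_zero.mp h)))
    · linarith
  · rw [hρ₁, hρ₃, div_left_inj' hD] at h
    have hfac : (ε ^ 2 - 1) * (ε ^ 2 + 1 - β ^ 2) = 0 := by linear_combination h / 4
    rcases mul_eq_zero.mp hfac with h | h
    · exact .inl (.inr (.inl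
        ((pow_eq_one_iff_of_nonneg hε0.le two_ne_zero).mp (sub_eq_zero.mp h))))
    · linarith
end

section
/- Let m > 0 and μ ∈ ℝ, and let f : ℝ → ℝ be a differentiable function defined on all of ℝ satisfying f′(t) − (1/m) f(t)² = μ for all t. If f attains a global maximum and a global minimum on ℝ, then f is constant. -/
/-- Let `m > 0`, `μ ∈ ℝ`, and let `f : ℝ → ℝ` be differentiable on all of `ℝ` with
`f'(t) - (1/m) f(t)² = μ` for all `t`.  If `f` attains a global maximum and a global
minimum on `ℝ`, then `f` is constant. -/
theorem ode_global_max_min_constant (m μ : ℝ) (hm : 0 < m) (f : ℝ → ℝ)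
    (hf : Differentiable ℝ f)
    (hode : ∀ t : ℝ, deriv f t - (1 / m) * f t ^ 2 = μ)
    (hmax : ∃ a : ℝ, ∀ t : ℝ, f t ≤ f a)
    (hmin : ∃ b : ℝ, ∀ t : ℝ, f b ≤ f t) :
    ∀ s t : ℝ, f s = f t := by
  obtain ⟨a, ha⟩ := hmax
  obtain ⟨b, hb⟩ := hmin
  have hda : deriv f a = 0 :=
    IsLocalMax.deriv_eq_zero (Filter.Eventually.of_forall ha)
  have hdb : deriv f b = 0 :=
    IsLocalMin.deriv_eq_zero (Filter.Eventually.of_forall hb)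
  have hm' : 0 < 1 / m := by positivity
  have hderiv : ∀ t, deriv f t = 1 / m * (f t ^ 2 - f a ^ 2) := fun t => by
    linarith [hode t, hode a]
  have hsq : f b ^ 2 = f a ^ 2 := by
    have h := hderiv b
    rw [hdb, eq_comm, mul_eq_zero, sub_eq_zero] at h
    exact h.resolve_left hm'.ne'
  suffices hab : f a ≤ f b from fun s t => by
    linarith [ha s, ha t, hb s, hb t]
  rcases sq_eq_sq_iff_eq_or_eq_neg.mp hsq with heq | hneg
  · exact heq.ge
  rcases le_total b a with hle | hle
  · have hanti : Antitone f := antitone_of_deriv_nonpos hf fun t => by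
      rw [hderiv]
      exact mul_nonpos_of_nonneg_of_nonpos hm'.le
        (by nlinarith [ha t, hb t])
    exact hanti hle
  · have hd : ∀ t, HasDerivAt (fun t => (f a - f t) * Real.exp (-(2 * f a / m) * t))
        (-(1 / m * (f a - f t) ^ 2 * Real.exp (-(2 * f a / m) * t))) t := fun t => by
      have h₁ := (hf t).hasDerivAt.const_sub (f a)
      have h₂ := ((hasDerivAt_id t).const_mul (-(2 * f a / m))).exp
      refine (h₁.mul h₂).congr_deriv ?_
      rw [hderiv]
      simp only [id]
      ring
    have hanti := antitone_of_hasDerivAt_nonpos hd fun t =>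
      neg_nonpos.mpr (by positivity)
    have h := hanti hle
    simp only [sub_self, zero_mul] at h
    exact sub_nonpos.mp (nonpos_of_mul_nonpos_left h (Real.exp_pos _))
end
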